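/- Let h : ℝ² → ℝ be a positively homogeneous function, let E* be an upper exhauster of h, let C₀ ∈ E*, let n be a positive integer, and let 0 = α₀ < α₁ < ⋯ < α_n = 2π be a partition of [0, 2π]. If for every j ∈ {0, 1, …, n−1} there exists a set C_j ∈ E* \ {C₀} satisfying ρ_{C_j}(θ) ≤ ρ_{C₀}(θ) for all θ ∈ [α_j, α_{j+1}], then the family E* \ {C₀} is again an upper exhauster of h. -/

import Mathlib

open Set Real
open scoped RealInnerProductSpace

noncomputable def suppFn (C : Set (EuclideanSpace ℝ (Fin 2))) (g : EuclideanSpace ℝ (Fin 2)) : ℝ :=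
  sSup ((fun v => ⟪v, g⟫) '' C)

def IsUpperExhauster (h : EuclideanSpace ℝ (Fin 2) → ℝ)
    (E : Set (Set (EuclideanSpace ℝ (Fin 2)))) : Prop :=
  (∀ C ∈ E, C.Nonempty ∧ IsCompact C ∧ Convex ℝ C) ∧
  ∀ g, IsGLB ((fun C => suppFn C g) '' E) (h g)

noncomputable def udir (θ : ℝ) : EuclideanSpace ℝ (Fin 2) :=
  (EuclideanSpace.equiv (Fin 2) ℝ).symm ![Real.cos θ, Real.sin θ]

noncomputable def rho (C : Set (EuclideanSpace ℝ (Fin 2))) (θ : ℝ) : ℝ := suppFn C (udir θ)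

lemma suppFn_smul (C : Set (EuclideanSpace ℝ (Fin 2))) {r : ℝ} (hr : 0 ≤ r)
    (g : EuclideanSpace ℝ (Fin 2)) : suppFn C (r • g) = r * suppFn C g := by
  unfold suppFn
  rw [← smul_eq_mul, ← Real.sSup_smul_of_nonneg hr, ← Set.image_smul, Set.image_image]
  simp only [inner_smul_right, smul_eq_mul]

lemma exists_eq_smul_udir (g : EuclideanSpace ℝ (Fin 2)) :
    ∃ r θ : ℝ, 0 ≤ r ∧ θ ∈ Icc 0 (2 * π) ∧ g = r • udir θ := by
  let z : ℂ := ⟨g 0, g 1⟩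
  have hpolar (θ : ℝ) (hc : Real.cos θ = Real.cos z.arg) (hs : Real.sin θ = Real.sin z.arg) :
      g = ‖z‖ • udir θ := by
    ext i
    fin_cases i
    · simp [udir, hc, z, Complex.norm_mul_cos_arg]
    · simp [udir, hs, z, Complex.norm_mul_sin_arg]
  rcases le_total 0 z.arg with hz | hz
  · exact ⟨‖z‖, z.arg, norm_nonneg z,
      ⟨hz, by linarith [Complex.arg_le_pi z, Real.pi_pos]⟩, hpolar _ rfl rfl⟩
  · exact ⟨‖z‖, z.arg + 2 * π, norm_nonneg z,
      ⟨by linarith [Complex.neg_pi_lt_arg z, Real.pi_pos], by linarith⟩,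
      hpolar _ (Real.cos_add_two_pi _) (Real.sin_add_two_pi _)⟩

lemma exists_mem_Icc_succ (α : ℕ → ℝ) {n : ℕ} (hn : 0 < n) {θ : ℝ}
    (hθ : θ ∈ Icc (α 0) (α n)) : ∃ j < n, θ ∈ Icc (α j) (α (j + 1)) := by
  induction n, hn using Nat.le_induction with
  | base => exact ⟨0, zero_lt_one, hθ⟩
  | succ m _ ih =>
    rcases le_total θ (α m) with hle | hle
    · obtain ⟨j, hj, hmem⟩ := ih ⟨hθ.1, hle⟩
      exact ⟨j, hj.trans m.lt_succ_self, hmem⟩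
    · exact ⟨m, m.lt_succ_self, hle, hθ.2⟩

lemma IsUpperExhauster.diff_singleton {h : EuclideanSpace ℝ (Fin 2) → ℝ}
    {E : Set (Set (EuclideanSpace ℝ (Fin 2)))} {C₀ : Set (EuclideanSpace ℝ (Fin 2))}
    (hE : IsUpperExhauster h E)
    (hdom : ∀ g, ∃ C ∈ E \ {C₀}, suppFn C g ≤ suppFn C₀ g) :
    IsUpperExhauster h (E \ {C₀}) := by
  refine ⟨fun C hC => hE.1 C hC.1, fun g => ⟨?_, fun b hb => (hE.2 g).2 ?_⟩⟩
  · rintro _ ⟨C, hC, rfl⟩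
    exact (hE.2 g).1 ⟨C, hC.1, rfl⟩
  · rintro _ ⟨C, hC, rfl⟩
    by_cases hCC : C = C₀
    · obtain ⟨D, hD, hle⟩ := hdom g
      exact hCC ▸ (hb ⟨D, hD, rfl⟩).trans hle
    · exact hb ⟨C, ⟨hC, hCC⟩, rfl⟩

theorem discard_of_piecewise_dominated
    (h : EuclideanSpace ℝ (Fin 2) → ℝ)
    (hph : ∀ (l : ℝ) (g : EuclideanSpace ℝ (Fin 2)), 0 ≤ l → h (l • g) = l * h g)
    (E : Set (Set (EuclideanSpace ℝ (Fin 2)))) (C₀ : Set (EuclideanSpace ℝ (Fin 2)))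
    (hE : IsUpperExhauster h E) (hC₀ : C₀ ∈ E)
    (n : ℕ) (hn : 0 < n) (α : ℕ → ℝ)
    (hα0 : α 0 = 0) (hαn : α n = 2 * π)
    (hmono : ∀ j < n, α j < α (j + 1))
    (hyp : ∀ j < n, ∃ C ∈ E \ {C₀}, ∀ θ ∈ Icc (α j) (α (j + 1)), rho C θ ≤ rho C₀ θ) :
    IsUpperExhauster h (E \ {C₀}) := by
  refine hE.diff_singleton fun g => ?_
  obtain ⟨r, θ, hr, hθ, rfl⟩ := exists_eq_smul_udir g
  rw [← hα0, ← hαn] at hθ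
  obtain ⟨j, hj, hθj⟩ := exists_mem_Icc_succ α hn hθ
  obtain ⟨C, hC, hle⟩ := hyp j hj
  refine ⟨C, hC, ?_⟩
  rw [suppFn_smul C hr, suppFn_smul C₀ hr]
  exact mul_le_mul_of_nonneg_left (hle θ hθj) hr
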